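/- For every m ≥ 1 and every t = (t₀,…,t_{2^m}) ∈ ℝ^{2^m+1}, the minimal level-m graph energy over all u : V_m → ℝ with u(x_j) = t_j on the bottom row satisfies Q_{Ẽ_m}(t) = Σ_{i=0}^{m} γ^m_i Σ_{j=0}^{2^{m−i}−1} (D^m_{m−i,j})², where the coefficients are determined by: γ^1_0 = 20, γ^m_n = (10/3)·γ^{m−1}_n for all m ≥ 2 and 0 ≤ n < m, and γ^m_m = 70·10^m/(5·3^m + 16·10^m) for all m ≥ 1. (In particular γ^m_0 = 20·(10/3)^{m−1} multiplies the finest-scale Haar coefficients D^m_{m,j}, and γ^m_m multiplies the coarsest coefficient D^m_{0,0}.) -/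

import Mathlib

open scoped BigOperators

noncomputable section

namespace SGPaper

/-- The three corners of the Sierpinski gasket:
`q₀ = (1/2, √3/2)`, `q₁ = (0,0)`, `q₂ = (1,0)`. -/
def q : Fin 3 → ℝ × ℝ
  | 0 => (1 / 2, Real.sqrt 3 / 2)
  | 1 => (0, 0)
  | 2 => (1, 0)

/-- The contraction map towards corner `i`: `F_i(x) = (x + q_i)/2`. -/
def Fmap (i : Fin 3) (x : ℝ × ℝ) : ℝ × ℝ := (2⁻¹ : ℝ) • (x + q i)

/-- `Fword w = F_{w₁} ∘ ⋯ ∘ F_{w_m}` for the word `w = w₁⋯w_m`. -/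
def Fword (w : List (Fin 3)) : ℝ × ℝ → ℝ × ℝ :=
  w.foldr (fun i f => Fmap i ∘ f) id

/-- The level-`m` vertex set of the Sierpinski gasket:
`V_m = ⋃_{|w| = m} F_w({q₀, q₁, q₂})`. -/
def V (m : ℕ) : Set (ℝ × ℝ) :=
  {x | ∃ w : List (Fin 3), w.length = m ∧ ∃ i : Fin 3, x = Fword w (q i)}

/-- `x` and `y` are `m`-neighbors: they are distinct and belong to a common
level-`m` cell `F_w({q₀, q₁, q₂})`. -/
def Nbr (m : ℕ) (x y : ℝ × ℝ) : Prop :=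
  x ≠ y ∧ ∃ w : List (Fin 3), w.length = m ∧
    (∃ i : Fin 3, x = Fword w (q i)) ∧ (∃ j : Fin 3, y = Fword w (q j))

/-- The value `(u x - u y)²` on the unordered pair `{x, y}`. -/
def edgeVal (u : ℝ × ℝ → ℝ) : Sym2 (ℝ × ℝ) → ℝ :=
  Sym2.lift ⟨fun x y => (u x - u y) ^ 2, fun _ _ => by ring⟩

/-- The unordered pair `e` is an edge of the level-`m` graph `Γ_m`. -/
def IsEdge (m : ℕ) (e : Sym2 (ℝ × ℝ)) : Prop :=
  ∃ x y : ℝ × ℝ, Nbr m x y ∧ e = s(x, y)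

/-- The level-`m` graph energy: `E_m(u) = (5/3)^m Σ (u x − u y)²`, the sum being over
unordered `m`-neighbor pairs `{x, y}` (a finite set, so `tsum` is the honest sum). -/
def Energy (m : ℕ) (u : ℝ × ℝ → ℝ) : ℝ :=
  (5 / 3 : ℝ) ^ m * ∑' e : {e : Sym2 (ℝ × ℝ) // IsEdge m e}, edgeVal u e

/-- `Q_E(v)`: minimal level-`m` energy among functions `u : V_m → ℝ` agreeing
with `v` on `E` (the minimum is attained, so it equals this infimum). -/
def Q (m : ℕ) (E : Set (ℝ × ℝ)) (v : ℝ × ℝ → ℝ) : ℝ :=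
  sInf {r | ∃ u : ℝ × ℝ → ℝ, (∀ x ∈ E, u x = v x) ∧ r = Energy m u}

/-- Indicator function of the point `z`. -/
def ind (z : ℝ × ℝ) : ℝ × ℝ → ℝ := fun t => if t = z then 1 else 0

/-- The conductance `c^E_{x,y} = (Q_E(𝟙_x) + Q_E(𝟙_y) − Q_E(𝟙_x + 𝟙_y))/2`
between `x, y ∈ E`, computed at level `m`. -/
def cond (m : ℕ) (E : Set (ℝ × ℝ)) (x y : ℝ × ℝ) : ℝ :=
  (Q m E (ind x) + Q m E (ind y) - Q m E (ind x + ind y)) / 2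

/-- The `j`-th bottom-row point of `V_n`: `x_j = q₁ + (j/2ⁿ)(q₂ − q₁)`. -/
def xb (n j : ℕ) : ℝ × ℝ := q 1 + ((j : ℝ) / 2 ^ n) • (q 2 - q 1)

/-- The bottom row `Ẽ_n = {x₀, …, x_{2ⁿ}}` of `V_n`. -/
def Ebot (n : ℕ) : Set (ℝ × ℝ) := {p | ∃ j ≤ 2 ^ n, p = xb n j}

/-- The bottom row together with the top point: `E_n⁺ = {q₀, x₀, …, x_{2ⁿ}}`. -/
def Eplus (n : ℕ) : Set (ℝ × ℝ) := insert (q 0) (Ebot n)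

/-- The Haar function `Ψ_{n,k}` on `[0,1]`. -/
def Psi (n k : ℕ) (s : ℝ) : ℝ :=
  if (k : ℝ) / 2 ^ n ≤ s ∧ s < ((k : ℝ) + 1 / 2) / 2 ^ n then (2 : ℝ) ^ ((n : ℝ) / 2)
  else if ((k : ℝ) + 1 / 2) / 2 ^ n < s ∧ s ≤ ((k : ℝ) + 1) / 2 ^ n then
    -(2 : ℝ) ^ ((n : ℝ) / 2)
  else 0

/-- The piecewise-constant interpolation `f_m(t)` on `[0,1]`: it equals `t i` on the
interval of the dyadic points nearest to `i/2^m`, i.e. `f_m(t)(s) = t ⌊s·2^m + 1/2⌋`. -/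
def fpc (m : ℕ) (t : ℕ → ℝ) (s : ℝ) : ℝ := t (⌊s * 2 ^ m + 1 / 2⌋.toNat)

/-- The Haar coefficient `D^m_{n,k}(t) = ∫₀¹ Ψ_{n,k}(s) f_m(t)(s) ds`. -/
def Dcoef (m : ℕ) (t : ℕ → ℝ) (n k : ℕ) : ℝ :=
  ∫ s in (0 : ℝ)..1, Psi n k s * fpc m t s


/-! ### Geometry -/

/-- Barycentric coordinates. -/
def lam : Fin 3 → ℝ × ℝ → ℝ
  | 0, x => 2 * (x.2 / Real.sqrt 3)
  | 1, x => 1 - x.1 - x.2 / Real.sqrt 3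
  | 2, x => x.1 - x.2 / Real.sqrt 3

lemma lam_sum (x : ℝ × ℝ) : lam 0 x + lam 1 x + lam 2 x = 1 := by
  simp only [lam]; ring

lemma sqrt3_ne : Real.sqrt 3 ≠ 0 := by positivity

lemma lam_q (i j : Fin 3) : lam j (q i) = if i = j then 1 else 0 := by
  have h := sqrt3_ne
  fin_cases i <;> fin_cases j <;> simp [lam, q] <;> field_simp <;> norm_num

lemma lam_Fmap (i j : Fin 3) (x : ℝ × ℝ) :
    lam j (Fmap i x) = (lam j x + if i = j then 1 else 0) / 2 := by
  rw [← lam_q i j]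
  fin_cases j <;> simp [lam, Fmap] <;> ring

lemma lam_ext {x y : ℝ × ℝ} (h : ∀ i, lam i x = lam i y) : x = y := by
  have h0 := h 0
  have h2 := h 2
  simp only [lam] at h0 h2
  have h3 : x.2 / Real.sqrt 3 = y.2 / Real.sqrt 3 := by linarith
  have h4 : x.2 = y.2 := by
    have := sqrt3_ne
    field_simp at h3
    exact h3
  exact Prod.ext (by linarith) h4

/-- The closed triangle. -/
def Tri (x : ℝ × ℝ) : Prop := ∀ i, 0 ≤ lam i x

lemma tri_q (i : Fin 3) : Tri (q i) := fun j => by rw [lam_q]; split_ifs <;> norm_num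

lemma tri_Fmap (i : Fin 3) {x : ℝ × ℝ} (h : Tri x) : Tri (Fmap i x) := fun j => by
  rw [lam_Fmap]; have := h j; split_ifs <;> linarith

lemma tri_Fword (w : List (Fin 3)) {x : ℝ × ℝ} (h : Tri x) : Tri (Fword w x) := by
  induction w with
  | nil => exact h
  | cons i w ih => exact tri_Fmap i ih

lemma Fmap_inj (i : Fin 3) : Function.Injective (Fmap i) := by
  intro x y h
  apply lam_ext
  intro j
  have := congrArg (lam j) h
  rw [lam_Fmap, lam_Fmap] at this
  linarith

lemma Fmap_meet {i j : Fin 3} (hij : i ≠ j) {x y : ℝ × ℝ} (hx : Tri x) (hy : Tri y)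
    (h : Fmap i x = Fmap j y) : x = q j ∧ y = q i := by
  have H : ∀ k, (lam k x + if i = k then 1 else 0) = (lam k y + if j = k then 1 else 0) := by
    intro k
    have := congrArg (lam k) h
    rw [lam_Fmap, lam_Fmap] at this
    linarith
  have sx := lam_sum x
  have sy := lam_sum y
  have H0 := H 0
  have H1 := H 1
  have H2 := H 2
  have x0 := hx 0
  have x1 := hx 1
  have x2 := hx 2
  have y0 := hy 0
  have y1 := hy 1
  have y2 := hy 2
  constructor <;> apply lam_ext <;> intro k <;> rw [lam_q] <;>
  fin_cases i <;> fin_cases j <;> simp at hij <;> fin_cases k <;>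
    simp at H0 H1 H2 ⊢ <;> linarith

lemma Fmap_q_comm (i j : Fin 3) : Fmap i (q j) = Fmap j (q i) := by
  simp [Fmap, add_comm]

lemma Fmap_q_self (i : Fin 3) : Fmap i (q i) = q i := by
  ext <;> simp [Fmap] <;> ring

/-! ### Energy -/

lemma edgeVal_map (u : ℝ × ℝ → ℝ) (f : ℝ × ℝ → ℝ × ℝ) (e : Sym2 (ℝ × ℝ)) :
    edgeVal u (Sym2.map f e) = edgeVal (u ∘ f) e := by
  induction e with | _ x y => rfl

lemma isEdge_succ (m : ℕ) (e : Sym2 (ℝ × ℝ)) :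
    IsEdge (m + 1) e ↔ ∃ i : Fin 3, ∃ e', IsEdge m e' ∧ e = Sym2.map (Fmap i) e' := by
  constructor
  · rintro ⟨x, y, ⟨hne, w, hw, ⟨i, rfl⟩, ⟨j, rfl⟩⟩, rfl⟩
    cases w with
    | nil => simp at hw
    | cons k w =>
      refine ⟨k, s(Fword w (q i), Fword w (q j)), ⟨_, _, ⟨?_, w, by simpa using hw,
        ⟨i, rfl⟩, ⟨j, rfl⟩⟩, rfl⟩, rfl⟩
      intro h
      exact hne (congrArg (Fmap k) h)
  · rintro ⟨k, e', ⟨x, y, ⟨hne, w, hw, ⟨i, rfl⟩, ⟨j, rfl⟩⟩, rfl⟩, rfl⟩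
    exact ⟨_, _, ⟨fun h => hne (Fmap_inj k h), k :: w, by simp [hw], ⟨i, rfl⟩, ⟨j, rfl⟩⟩, rfl⟩

lemma isEdge_tri {m : ℕ} {x y : ℝ × ℝ} (h : IsEdge m s(x, y)) : x ≠ y ∧ Tri x ∧ Tri y := by
  obtain ⟨a, b, ⟨hne, w, hw, ⟨i, rfl⟩, ⟨j, rfl⟩⟩, he⟩ := h
  have ti := tri_Fword w (tri_q i)
  have tj := tri_Fword w (tri_q j)
  rcases Sym2.eq_iff.1 he with ⟨rfl, rfl⟩ | ⟨rfl, rfl⟩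
  · exact ⟨hne, ti, tj⟩
  · exact ⟨hne.symm, tj, ti⟩

/-- The edge map from three copies of level `m`. -/
def edgeMap (m : ℕ) (p : Fin 3 × {e : Sym2 (ℝ × ℝ) // IsEdge m e}) :
    {e : Sym2 (ℝ × ℝ) // IsEdge (m + 1) e} :=
  ⟨Sym2.map (Fmap p.1) p.2.1, (isEdge_succ m _).2 ⟨p.1, p.2.1, p.2.2, rfl⟩⟩

lemma edgeMap_bij (m : ℕ) : Function.Bijective (edgeMap m) := by
  constructor
  · rintro ⟨i, e, he⟩ ⟨j, f, hf⟩ h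
    have h' : Sym2.map (Fmap i) e = Sym2.map (Fmap j) f := congrArg Subtype.val h
    by_cases hij : i = j
    · subst hij
      have := Sym2.map.injective (Fmap_inj i) h'
      subst this
      rfl
    · exfalso
      induction e with | _ x y =>
      induction f with | _ z w =>
      obtain ⟨h1, h2, h3⟩ := isEdge_tri he
      obtain ⟨h4, h5, h6⟩ := isEdge_tri hf
      simp only [Sym2.map_mk] at h'
      rcases Sym2.eq_iff.1 h' with ⟨a, b⟩ | ⟨a, b⟩
      · exact h1 ((Fmap_meet hij h2 h5 a).1.trans (Fmap_meet hij h3 h6 b).1.symm)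
      · exact h1 ((Fmap_meet hij h2 h6 a).1.trans (Fmap_meet hij h3 h5 b).1.symm)
  · rintro ⟨e, he⟩
    obtain ⟨i, e', he', rfl⟩ := (isEdge_succ m e).1 he
    exact ⟨⟨i, e', he'⟩, rfl⟩

lemma isEdge_zero (e : Sym2 (ℝ × ℝ)) :
    IsEdge 0 e ↔ e ∈ ({s(q 0, q 1), s(q 0, q 2), s(q 1, q 2)} : Finset (Sym2 (ℝ × ℝ))) := by
  have hq : ∀ i j : Fin 3, i ≠ j → q i ≠ q j := by
    intro i j hij h
    have := congrArg (lam i) h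
    rw [lam_q, lam_q] at this
    simp [Ne.symm hij] at this
  constructor
  · rintro ⟨x, y, ⟨hne, w, hw, ⟨i, rfl⟩, ⟨j, rfl⟩⟩, rfl⟩
    obtain rfl := List.length_eq_zero_iff.1 hw
    simp only [Fword, List.foldr_nil, id] at *
    fin_cases i <;> fin_cases j <;> simp at hne ⊢
  · intro h
    simp only [Finset.mem_insert, Finset.mem_singleton] at h
    rcases h with rfl | rfl | rfl
    · exact ⟨_, _, ⟨hq 0 1 (by decide), [], rfl, ⟨0, rfl⟩, ⟨1, rfl⟩⟩, rfl⟩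
    · exact ⟨_, _, ⟨hq 0 2 (by decide), [], rfl, ⟨0, rfl⟩, ⟨2, rfl⟩⟩, rfl⟩
    · exact ⟨_, _, ⟨hq 1 2 (by decide), [], rfl, ⟨1, rfl⟩, ⟨2, rfl⟩⟩, rfl⟩

lemma finite_edges (m : ℕ) : Finite {e : Sym2 (ℝ × ℝ) // IsEdge m e} := by
  induction m with
  | zero =>
    simp only [isEdge_zero]
    infer_instance
  | succ m ih => exact Finite.of_surjective _ (edgeMap_bij m).2

lemma Energy_zero (u : ℝ × ℝ → ℝ) : Energy 0 u =
    (u (q 0) - u (q 1)) ^ 2 + (u (q 0) - u (q 2)) ^ 2 + (u (q 1) - u (q 2)) ^ 2 := by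
  have hq : ∀ i j : Fin 3, i ≠ j → q i ≠ q j := by
    intro i j hij h
    have := congrArg (lam i) h
    rw [lam_q, lam_q] at this
    simp [Ne.symm hij] at this
  have h01 := hq 0 1 (by decide)
  have h02 := hq 0 2 (by decide)
  have h12 := hq 1 2 (by decide)
  unfold Energy
  rw [pow_zero, one_mul]
  have : {e : Sym2 (ℝ × ℝ) | IsEdge 0 e} =
      (({s(q 0, q 1), s(q 0, q 2), s(q 1, q 2)} : Finset (Sym2 (ℝ × ℝ))) : Set _) := by
    ext e; exact isEdge_zero e
  change ∑' e : ({e : Sym2 (ℝ × ℝ) | IsEdge 0 e} : Set _), edgeVal u e = _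
  rw [this, Finset.tsum_subtype' _ (edgeVal u), Finset.sum_insert, Finset.sum_insert,
    Finset.sum_singleton]
  · simp only [edgeVal, Sym2.lift_mk]; ring
  · simp [h01, h02, h12, h01.symm, h02.symm, h12.symm]
  · simp [h01, h02, h12, h01.symm, h02.symm, h12.symm]

lemma Energy_succ (m : ℕ) (u : ℝ × ℝ → ℝ) : Energy (m + 1) u =
    5 / 3 * (Energy m (u ∘ Fmap 0) + Energy m (u ∘ Fmap 1) + Energy m (u ∘ Fmap 2)) := by
  unfold Energy
  have := finite_edges m
  have := Fintype.ofFinite {e : Sym2 (ℝ × ℝ) // IsEdge m e}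
  rw [← (Equiv.ofBijective _ (edgeMap_bij m)).tsum_eq, tsum_fintype, Fintype.sum_prod_type,
    Fin.sum_univ_three, tsum_fintype, tsum_fintype, tsum_fintype]
  simp only [Equiv.ofBijective_apply, edgeMap, edgeVal_map]
  ring

lemma Energy_congr (m : ℕ) {u v : ℝ × ℝ → ℝ} (h : ∀ x, Tri x → u x = v x) :
    Energy m u = Energy m v := by
  unfold Energy
  congr 1
  apply tsum_congr
  rintro ⟨e, he⟩
  induction e with | _ x y =>
  obtain ⟨_, h2, h3⟩ := isEdge_tri he
  simp [edgeVal, h _ h2, h _ h3]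

lemma glue (u : Fin 3 → ℝ × ℝ → ℝ) (h : ∀ i j, u i (q j) = u j (q i)) :
    ∃ U : ℝ × ℝ → ℝ, ∀ i x, Tri x → U (Fmap i x) = u i x := by
  classical
  refine ⟨fun y => if H : ∃ p : Fin 3 × (ℝ × ℝ), Tri p.2 ∧ y = Fmap p.1 p.2 then
    u H.choose.1 H.choose.2 else 0, ?_⟩
  intro i x hx
  have H : ∃ p : Fin 3 × (ℝ × ℝ), Tri p.2 ∧ Fmap i x = Fmap p.1 p.2 := ⟨(i, x), hx, rfl⟩
  simp only [dif_pos H]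
  obtain ⟨h1, h2⟩ := H.choose_spec
  generalize H.choose = p at h1 h2
  obtain ⟨j, y⟩ := p
  simp only at *
  by_cases hij : i = j
  · subst hij
    rw [Fmap_inj i h2]
  · obtain ⟨rfl, rfl⟩ := Fmap_meet hij hx h1 h2
    exact h _ _

lemma glue_energy (m : ℕ) (u : Fin 3 → ℝ × ℝ → ℝ) (h : ∀ i j, u i (q j) = u j (q i)) :
    ∃ U : ℝ × ℝ → ℝ, (∀ i x, Tri x → U (Fmap i x) = u i x) ∧
      Energy (m + 1) U = 5 / 3 * (Energy m (u 0) + Energy m (u 1) + Energy m (u 2)) := by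
  obtain ⟨U, hU⟩ := glue u h
  refine ⟨U, hU, ?_⟩
  rw [Energy_succ, Energy_congr m (u := U ∘ Fmap 0) (hU 0), Energy_congr m (u := U ∘ Fmap 1) (hU 1), Energy_congr m (u := U ∘ Fmap 2) (hU 2)]

lemma Energy_ge (m : ℕ) (u : ℝ × ℝ → ℝ) :
    (u (q 0) - u (q 1)) ^ 2 + (u (q 0) - u (q 2)) ^ 2 + (u (q 1) - u (q 2)) ^ 2
      ≤ Energy m u := by
  induction m generalizing u with
  | zero => rw [Energy_zero]
  | succ m ih =>
    rw [Energy_succ]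
    have h0 := ih (u ∘ Fmap 0)
    have h1 := ih (u ∘ Fmap 1)
    have h2 := ih (u ∘ Fmap 2)
    simp only [Function.comp_apply, Fmap_q_self, Fmap_q_comm 1 0, Fmap_q_comm 2 0,
      Fmap_q_comm 2 1] at h0 h1 h2
    generalize u (q 0) = a at *
    generalize u (q 1) = b at *
    generalize u (q 2) = c at *
    generalize u (Fmap 0 (q 1)) = x at *
    generalize u (Fmap 0 (q 2)) = y at *
    generalize u (Fmap 1 (q 2)) = z at *
    nlinarith [sq_nonneg (5 * (x + y + z) - 5 * (a + b + c)),
      sq_nonneg ((x + y - 2 * z) - (a * 1 + b * 1 + c * (-2)) * (-1 / 5) * (-1)),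
      sq_nonneg ((x - y) - (b - c) / 5),
      sq_nonneg (x - (2 * a + 2 * b + c) / 5), sq_nonneg (y - (2 * a + 2 * c + b) / 5),
      sq_nonneg (z - (2 * b + 2 * c + a) / 5),
      sq_nonneg (x - (2 * a + 2 * b + c) / 5 - (y - (2 * a + 2 * c + b) / 5)),
      sq_nonneg (x - (2 * a + 2 * b + c) / 5 - (z - (2 * b + 2 * c + a) / 5)),
      sq_nonneg (y - (2 * a + 2 * c + b) / 5 - (z - (2 * b + 2 * c + a) / 5))]

lemma Energy_harm (m : ℕ) (a b c : ℝ) : ∃ u : ℝ × ℝ → ℝ, u (q 0) = a ∧ u (q 1) = b ∧ u (q 2) = c ∧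
    Energy m u = (a - b) ^ 2 + (a - c) ^ 2 + (b - c) ^ 2 := by
  induction m generalizing a b c with
  | zero =>
    refine ⟨fun x => a * lam 0 x + b * lam 1 x + c * lam 2 x, ?_, ?_, ?_, ?_⟩
    · simp [lam_q]
    · simp [lam_q]
    · simp [lam_q]
    · rw [Energy_zero]; simp [lam_q]
  | succ m ih =>
    obtain ⟨u0, a0, b0, c0, e0⟩ := ih a ((2 * a + 2 * b + c) / 5) ((2 * a + 2 * c + b) / 5)
    obtain ⟨u1, a1, b1, c1, e1⟩ := ih ((2 * a + 2 * b + c) / 5) b ((2 * b + 2 * c + a) / 5)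
    obtain ⟨u2, a2, b2, c2, e2⟩ := ih ((2 * a + 2 * c + b) / 5) ((2 * b + 2 * c + a) / 5) c
    obtain ⟨U, hU, hE⟩ := glue_energy m ![u0, u1, u2] (by
      intro i j
      fin_cases i <;> fin_cases j <;> simp [*])
    have k0 := hU 0 (q 0) (tri_q 0)
    have k1 := hU 1 (q 1) (tri_q 1)
    have k2 := hU 2 (q 2) (tri_q 2)
    rw [Fmap_q_self] at k0 k1 k2
    refine ⟨U, by simp [k0, a0], by simp [k1, b1], by simp [k2, c2], ?_⟩
    rw [hE]
    simp only [Matrix.cons_val]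
    rw [e0, e1, e2]
    ring

/-! ### Haar coefficients -/

lemma fpc_meas (m : ℕ) (t : ℕ → ℝ) : Measurable (fpc m t) := by
  have h1 : Measurable (fun s : ℝ => ⌊s * 2 ^ m + 1 / 2⌋) := by
    apply Measurable.floor
    fun_prop
  exact (measurable_of_countable (fun z : ℤ => t z.toNat)).comp h1

lemma Psi_meas (n k : ℕ) : Measurable (Psi n k) := by
  unfold Psi
  refine Measurable.ite ?_ measurable_const (Measurable.ite ?_ measurable_const measurable_const)
  · exact measurableSet_Ico
  · exact measurableSet_Ioc

lemma fpc_bound (m : ℕ) (t : ℕ → ℝ) (s : ℝ) (hs : s ≤ 1) :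
    |fpc m t s| ≤ ∑ i ∈ Finset.range (2 ^ m + 1), |t i| := by
  unfold fpc
  apply Finset.single_le_sum (f := fun i => |t i|) (fun i _ => abs_nonneg _)
  rw [Finset.mem_range, Nat.lt_succ_iff, Int.toNat_le, ← Int.lt_add_one_iff, Int.floor_lt]
  push_cast
  have : (0 : ℝ) < 2 ^ m := by positivity
  nlinarith

lemma Psi_bound (n k : ℕ) (s : ℝ) : |Psi n k s| ≤ (2 : ℝ) ^ ((n : ℝ) / 2) := by
  have : (0 : ℝ) < (2 : ℝ) ^ ((n : ℝ) / 2) := by positivity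
  unfold Psi
  split_ifs
  · rw [abs_of_pos this]
  · rw [abs_neg, abs_of_pos this]
  · rw [abs_zero]; exact this.le

lemma fpc_int (m : ℕ) (t : ℕ → ℝ) : IntervalIntegrable (fpc m t) MeasureTheory.volume 0 1 := by
  rw [intervalIntegrable_iff_integrableOn_Ioc_of_le zero_le_one]
  apply MeasureTheory.Measure.integrableOn_of_bounded
    (M := ∑ i ∈ Finset.range (2 ^ m + 1), |t i|)
  · simp
  · exact (fpc_meas m t).aestronglyMeasurable
  · filter_upwards [MeasureTheory.ae_restrict_mem measurableSet_Ioc] with s hs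
    exact fpc_bound m t s hs.2

lemma Psi_fpc_int (n k m : ℕ) (t : ℕ → ℝ) :
    IntervalIntegrable (fun s => Psi n k s * fpc m t s) MeasureTheory.volume 0 1 := by
  rw [intervalIntegrable_iff_integrableOn_Ioc_of_le zero_le_one]
  apply MeasureTheory.Measure.integrableOn_of_bounded
    (M := (2 : ℝ) ^ ((n : ℝ) / 2) * ∑ i ∈ Finset.range (2 ^ m + 1), |t i|)
  · simp
  · exact ((Psi_meas n k).mul (fpc_meas m t)).aestronglyMeasurable
  · filter_upwards [MeasureTheory.ae_restrict_mem measurableSet_Ioc] with s hs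
    rw [Real.norm_eq_abs, abs_mul]
    exact mul_le_mul (Psi_bound n k s) (fpc_bound m t s hs.2) (abs_nonneg _) (by positivity)

lemma integral_split (g : ℝ → ℝ) (hg : IntervalIntegrable g MeasureTheory.volume 0 1) :
    ∫ s in (0 : ℝ)..1, g s =
      ((∫ s in (0 : ℝ)..1, g (s / 2)) + ∫ s in (0 : ℝ)..1, g (s / 2 + 1 / 2)) / 2 := by
  have h1 := intervalIntegral.integral_comp_div_add (a := 0) (b := 1) g
    (two_ne_zero : (2 : ℝ) ≠ 0) (1 / 2)
  have h0 := intervalIntegral.integral_comp_div_add (a := 0) (b := 1) g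
    (two_ne_zero : (2 : ℝ) ≠ 0) 0
  simp only [add_zero] at h0
  rw [h0, h1]
  norm_num
  rw [← mul_add, intervalIntegral.integral_add_adjacent_intervals]
  · ring
  · exact hg.mono_set (by
      rw [Set.uIcc_of_le (by norm_num), Set.uIcc_of_le (by norm_num)]
      exact Set.Icc_subset_Icc (by norm_num) (by norm_num))
  · exact hg.mono_set (by
      rw [Set.uIcc_of_le (by norm_num), Set.uIcc_of_le (by norm_num)]
      exact Set.Icc_subset_Icc (by norm_num) (by norm_num))

lemma fpc_left (m : ℕ) (t : ℕ → ℝ) (s : ℝ) : fpc (m + 1) t (s / 2) = fpc m t s := by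
  unfold fpc
  congr 4
  rw [pow_succ]; ring

lemma fpc_right (m : ℕ) (t : ℕ → ℝ) (s : ℝ) (hs : 0 ≤ s) :
    fpc (m + 1) t (s / 2 + 1 / 2) = fpc m (fun j => t (j + 2 ^ m)) s := by
  unfold fpc
  have : (s / 2 + 1 / 2) * 2 ^ (m + 1) + 1 / 2 = (s * 2 ^ m + 1 / 2) + ((2 ^ m : ℕ) : ℝ) := by
    push_cast
    rw [pow_succ]; ring
  rw [this, Int.floor_add_natCast]
  have h0 : 0 ≤ ⌊s * 2 ^ m + 1 / 2⌋ := Int.floor_nonneg.2 (by positivity)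
  generalize ⌊s * 2 ^ m + 1 / 2⌋ = z at h0 ⊢
  generalize (2 ^ m : ℕ) = N
  congr 1
  omega

lemma rpow_half_succ (n : ℕ) : (2 : ℝ) ^ (((n + 1 : ℕ) : ℝ) / 2) =
    (2 : ℝ) ^ (1 / 2 : ℝ) * (2 : ℝ) ^ ((n : ℝ) / 2) := by
  rw [← Real.rpow_add two_pos]
  congr 1
  push_cast; ring

lemma rpow_half_sq : ((2 : ℝ) ^ (1 / 2 : ℝ)) ^ 2 = 2 := by
  rw [← Real.sqrt_eq_rpow, Real.sq_sqrt two_pos.le]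

lemma Psi_scale (n k l : ℕ) (s s' : ℝ)
    (h : s' * 2 ^ (n + 1) - l = s * 2 ^ n - k) :
    Psi (n + 1) l s' = (2 : ℝ) ^ (1 / 2 : ℝ) * Psi n k s := by
  unfold Psi
  have p1 : (0 : ℝ) < 2 ^ (n + 1) := by positivity
  have p2 : (0 : ℝ) < 2 ^ n := by positivity
  have e1 : ((l : ℝ) / 2 ^ (n + 1) ≤ s') ↔ ((k : ℝ) / 2 ^ n ≤ s) := by
    rw [div_le_iff₀ p1, div_le_iff₀ p2]; constructor <;> intro _ <;> linarith
  have e2 : (s' < ((l : ℝ) + 1 / 2) / 2 ^ (n + 1)) ↔ (s < ((k : ℝ) + 1 / 2) / 2 ^ n) := by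
    rw [lt_div_iff₀ p1, lt_div_iff₀ p2]; constructor <;> intro _ <;> linarith
  have e3 : (((l : ℝ) + 1 / 2) / 2 ^ (n + 1) < s') ↔ (((k : ℝ) + 1 / 2) / 2 ^ n < s) := by
    rw [div_lt_iff₀ p1, div_lt_iff₀ p2]; constructor <;> intro _ <;> linarith
  have e4 : (s' ≤ ((l : ℝ) + 1) / 2 ^ (n + 1)) ↔ (s ≤ ((k : ℝ) + 1) / 2 ^ n) := by
    rw [le_div_iff₀ p1, le_div_iff₀ p2]; constructor <;> intro _ <;> linarith
  simp only [e1, e2, e3, e4, rpow_half_succ]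
  split_ifs <;> ring

lemma Psi_zero_of_gt (n k : ℕ) (s : ℝ) (h : (k : ℝ) + 1 < s * 2 ^ n) : Psi n k s = 0 := by
  unfold Psi
  have p2 : (0 : ℝ) < 2 ^ n := by positivity
  rw [if_neg, if_neg]
  · rintro ⟨_, h2⟩
    rw [le_div_iff₀ p2] at h2; linarith
  · rintro ⟨_, h2⟩
    rw [lt_div_iff₀ p2] at h2; linarith

lemma Psi_zero_of_lt (n k : ℕ) (s : ℝ) (h : s * 2 ^ n < (k : ℝ)) : Psi n k s = 0 := by
  unfold Psi
  have p2 : (0 : ℝ) < 2 ^ n := by positivity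
  rw [if_neg, if_neg]
  · rintro ⟨h2, _⟩
    rw [div_lt_iff₀ p2] at h2; linarith
  · rintro ⟨h2, _⟩
    rw [div_le_iff₀ p2] at h2; linarith

lemma Dcoef_left (m n k : ℕ) (t : ℕ → ℝ) (hk : k < 2 ^ n) :
    Dcoef (m + 1) t (n + 1) k = (2 : ℝ) ^ (1 / 2 : ℝ) / 2 * Dcoef m t n k := by
  unfold Dcoef
  rw [integral_split _ (Psi_fpc_int _ _ _ _)]
  have hk' : (k : ℝ) + 1 ≤ 2 ^ n := by exact_mod_cast hk
  have p2 : (0 : ℝ) < 2 ^ n := by positivity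
  have h1 : ∫ s in (0 : ℝ)..1, Psi (n + 1) k (s / 2) * fpc (m + 1) t (s / 2) =
      ∫ s in (0 : ℝ)..1, (2 : ℝ) ^ (1 / 2 : ℝ) * (Psi n k s * fpc m t s) := by
    apply intervalIntegral.integral_congr_Ioo_of_le zero_le_one
    intro s hs
    simp only
    rw [fpc_left, Psi_scale n k k s (s / 2) (by rw [pow_succ]; ring)]
    ring
  have h2 : ∫ s in (0 : ℝ)..1, Psi (n + 1) k (s / 2 + 1 / 2) * fpc (m + 1) t (s / 2 + 1 / 2) =
      ∫ s in (0 : ℝ)..1, (0 : ℝ) := by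
    apply intervalIntegral.integral_congr_Ioo_of_le zero_le_one
    intro s hs
    simp only
    rw [Psi_zero_of_gt, zero_mul]
    rw [pow_succ]
    nlinarith [hs.1, mul_pos hs.1 p2]
  rw [h1, h2, intervalIntegral.integral_const_mul]
  simp
  ring

lemma Dcoef_right (m n k : ℕ) (t : ℕ → ℝ) :
    Dcoef (m + 1) t (n + 1) (2 ^ n + k) =
      (2 : ℝ) ^ (1 / 2 : ℝ) / 2 * Dcoef m (fun j => t (j + 2 ^ m)) n k := by
  unfold Dcoef
  rw [integral_split _ (Psi_fpc_int _ _ _ _)]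
  have p2 : (0 : ℝ) < 2 ^ n := by positivity
  have h1 : ∫ s in (0 : ℝ)..1, Psi (n + 1) (2 ^ n + k) (s / 2 + 1 / 2) *
        fpc (m + 1) t (s / 2 + 1 / 2) =
      ∫ s in (0 : ℝ)..1, (2 : ℝ) ^ (1 / 2 : ℝ) *
        (Psi n k s * fpc m (fun j => t (j + 2 ^ m)) s) := by
    apply intervalIntegral.integral_congr_Ioo_of_le zero_le_one
    intro s hs
    simp only
    rw [fpc_right _ _ _ hs.1.le, Psi_scale n k (2 ^ n + k) s (s / 2 + 1 / 2)
      (by rw [pow_succ]; push_cast; ring)]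
    ring
  have h2 : ∫ s in (0 : ℝ)..1, Psi (n + 1) (2 ^ n + k) (s / 2) * fpc (m + 1) t (s / 2) =
      ∫ s in (0 : ℝ)..1, (0 : ℝ) := by
    apply intervalIntegral.integral_congr_Ioo_of_le zero_le_one
    intro s hs
    simp only
    rw [Psi_zero_of_lt, zero_mul]
    rw [pow_succ]
    push_cast
    have : (0 : ℝ) ≤ k := by positivity
    nlinarith [hs.2]
  rw [h1, h2, intervalIntegral.integral_const_mul]
  simp
  ring

/-- The mean of the interpolation. -/
def Mean (m : ℕ) (t : ℕ → ℝ) : ℝ := ∫ s in (0 : ℝ)..1, fpc m t s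

lemma Psi00_left {s : ℝ} (hs : s ∈ Set.Ioo (0 : ℝ) 1) : Psi 0 0 (s / 2) = 1 := by
  unfold Psi
  rw [if_pos]
  · norm_num
  · have := hs.1
    have := hs.2
    constructor <;> norm_num <;> linarith

lemma Psi00_right {s : ℝ} (hs : s ∈ Set.Ioo (0 : ℝ) 1) : Psi 0 0 (s / 2 + 1 / 2) = -1 := by
  have := hs.1
  have := hs.2
  unfold Psi
  rw [if_neg, if_pos]
  · norm_num
  · constructor <;> norm_num <;> linarith
  · rintro ⟨_, h⟩
    norm_num at h
    linarith

lemma Mean_succ (m : ℕ) (t : ℕ → ℝ) :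
    Mean (m + 1) t = (Mean m t + Mean m (fun j => t (j + 2 ^ m))) / 2 := by
  unfold Mean
  rw [integral_split _ (fpc_int _ _)]
  congr 2
  · apply intervalIntegral.integral_congr_Ioo_of_le zero_le_one
    intro s hs
    exact fpc_left m t s
  · apply intervalIntegral.integral_congr_Ioo_of_le zero_le_one
    intro s hs
    exact fpc_right m t s hs.1.le

lemma Dcoef00_succ (m : ℕ) (t : ℕ → ℝ) :
    Dcoef (m + 1) t 0 0 = (Mean m t - Mean m (fun j => t (j + 2 ^ m))) / 2 := by
  unfold Mean Dcoef
  rw [integral_split _ (Psi_fpc_int _ _ _ _), sub_eq_add_neg, ← intervalIntegral.integral_neg]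
  congr 2
  · apply intervalIntegral.integral_congr_Ioo_of_le zero_le_one
    intro s hs
    simp only
    rw [fpc_left m t s, Psi00_left hs, one_mul]
  · apply intervalIntegral.integral_congr_Ioo_of_le zero_le_one
    intro s hs
    simp only
    rw [fpc_right m t s hs.1.le, Psi00_right hs]
    ring

lemma fpc_zero_left (t : ℕ → ℝ) {s : ℝ} (hs : s ∈ Set.Ioo (0 : ℝ) 1) : fpc 0 t (s / 2) = t 0 := by
  unfold fpc
  have : ⌊s / 2 * 2 ^ 0 + 1 / 2⌋ = 0 := by
    rw [Int.floor_eq_iff]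
    have := hs.1
    have := hs.2
    constructor <;> norm_num <;> linarith
  rw [this]; rfl

lemma fpc_zero_right (t : ℕ → ℝ) {s : ℝ} (hs : s ∈ Set.Ioo (0 : ℝ) 1) :
    fpc 0 t (s / 2 + 1 / 2) = t 1 := by
  unfold fpc
  have : ⌊(s / 2 + 1 / 2) * 2 ^ 0 + 1 / 2⌋ = 1 := by
    rw [Int.floor_eq_iff]
    have := hs.1
    have := hs.2
    constructor <;> norm_num <;> linarith
  rw [this]; rfl

lemma Mean_zero (t : ℕ → ℝ) : Mean 0 t = (t 0 + t 1) / 2 := by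
  unfold Mean
  rw [integral_split _ (fpc_int _ _),
    intervalIntegral.integral_congr_Ioo_of_le zero_le_one (g := fun _ => t 0)
      (fun s hs => fpc_zero_left t hs),
    intervalIntegral.integral_congr_Ioo_of_le zero_le_one (g := fun _ => t 1)
      (fun s hs => fpc_zero_right t hs)]
  simp

lemma Dcoef_zero (t : ℕ → ℝ) : Dcoef 0 t 0 0 = (t 0 - t 1) / 2 := by
  unfold Dcoef
  have h1 : ∫ s in (0 : ℝ)..1, Psi 0 0 (s / 2) * fpc 0 t (s / 2) = ∫ s in (0 : ℝ)..1, t 0 := by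
    apply intervalIntegral.integral_congr_Ioo_of_le zero_le_one
    intro s hs
    simp only
    rw [fpc_zero_left t hs, Psi00_left hs, one_mul]
  have h2 : ∫ s in (0 : ℝ)..1, Psi 0 0 (s / 2 + 1 / 2) * fpc 0 t (s / 2 + 1 / 2) =
      ∫ s in (0 : ℝ)..1, - t 1 := by
    apply intervalIntegral.integral_congr_Ioo_of_le zero_le_one
    intro s hs
    simp only
    rw [fpc_zero_right t hs, Psi00_right hs]
    ring
  rw [integral_split _ (Psi_fpc_int _ _ _ _), h1, h2]
  simp
  ring

/-! ### The coefficients -/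

/-- Diagonal coefficients, with the level-zero value adjoined. -/
def gd (i : ℕ) : ℝ := if i = 0 then 6 else 70 * 10 ^ i / (5 * 3 ^ i + 16 * 10 ^ i)

/-- Closed form of the coefficients. -/
def gam (m i : ℕ) : ℝ := (10 / 3) ^ (m - i) * gd i

/-- The right-hand side. -/
def S (m : ℕ) (t : ℕ → ℝ) : ℝ := ∑ i ∈ Finset.range (m + 1), gam m i *
        ∑ j ∈ Finset.range (2 ^ (m - i)), (Dcoef m t (m - i) j) ^ 2

lemma S_zero (t : ℕ → ℝ) : S 0 t = 3 / 2 * (t 0 - t 1) ^ 2 := by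
  simp [S, gam, gd, Dcoef_zero]
  ring

lemma S_succ (m : ℕ) (t : ℕ → ℝ) : S (m + 1) t =
    5 / 3 * (S m t + S m (fun j => t (j + 2 ^ m))) +
      gd (m + 1) * ((Mean m t - Mean m (fun j => t (j + 2 ^ m))) / 2) ^ 2 := by
  unfold S
  rw [Finset.sum_range_succ]
  congr 1
  · rw [← Finset.sum_add_distrib, Finset.mul_sum]
    apply Finset.sum_congr rfl
    intro i hi
    have hi' : i ≤ m := Nat.lt_succ_iff.1 (Finset.mem_range.1 hi)
    have e : m + 1 - i = (m - i) + 1 := by omega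
    have h2 : (((2 : ℝ) ^ (1 / 2 : ℝ)) / 2) ^ 2 = 1 / 2 := by
      rw [div_pow, rpow_half_sq]; norm_num
    rw [e, pow_succ 2, mul_two, Finset.sum_range_add]
    have a1 : ∑ x ∈ Finset.range (2 ^ (m - i)), Dcoef (m + 1) t (m - i + 1) x ^ 2 =
        1 / 2 * ∑ x ∈ Finset.range (2 ^ (m - i)), Dcoef m t (m - i) x ^ 2 := by
      rw [Finset.mul_sum]
      apply Finset.sum_congr rfl
      intro x hx
      rw [Dcoef_left _ _ _ _ (Finset.mem_range.1 hx), mul_pow, h2]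
    have a2 : ∑ x ∈ Finset.range (2 ^ (m - i)),
          Dcoef (m + 1) t (m - i + 1) (2 ^ (m - i) + x) ^ 2 =
        1 / 2 * ∑ x ∈ Finset.range (2 ^ (m - i)),
          Dcoef m (fun j => t (j + 2 ^ m)) (m - i) x ^ 2 := by
      rw [Finset.mul_sum]
      apply Finset.sum_congr rfl
      intro x hx
      rw [Dcoef_right, mul_pow, h2]
    rw [a1, a2]
    unfold gam
    rw [e, pow_succ]
    ring
  · simp [gam, Dcoef00_succ]

/-- The effective conductance from the top corner. -/
def cc (m : ℕ) : ℝ := 14 * 10 ^ m / (6 * 10 ^ m + 3 ^ m)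

lemma cc_pos (m : ℕ) : 0 < cc m := by unfold cc; positivity

lemma cc_succ (m : ℕ) : cc (m + 1) = 5 / 3 * (2 * cc m / (1 + cc m)) := by
  unfold cc
  have h1 : (0 : ℝ) < 10 ^ m := by positivity
  have h2 : (0 : ℝ) < 3 ^ m := by positivity
  rw [pow_succ, pow_succ]
  generalize (10 : ℝ) ^ m = a at *
  generalize (3 : ℝ) ^ m = b at *
  have : 6 * a + b + 14 * a ≠ 0 := by positivity
  field_simp
  ring

lemma gd_succ (m : ℕ) : gd (m + 1) = 5 / 3 * (6 * cc m / (3 + cc m)) := by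
  unfold cc gd
  have h1 : (0 : ℝ) < 10 ^ m := by positivity
  have h2 : (0 : ℝ) < 3 ^ m := by positivity
  rw [if_neg (Nat.succ_ne_zero m), pow_succ, pow_succ]
  generalize (10 : ℝ) ^ m = a at *
  generalize (3 : ℝ) ^ m = b at *
  field_simp
  ring

lemma min_identity (a y z L R c : ℝ) (hc : 0 < c) :
    ((a - y) ^ 2 + (a - z) ^ 2 + (y - z) ^ 2) + c * (y - L) ^ 2 + c * (z - R) ^ 2 =
      2 * c / (1 + c) * (a - (L + R) / 2) ^ 2 + 6 * c / (3 + c) * ((L - R) / 2) ^ 2 +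
      2 * (1 + c) * ((y + z) / 2 - (a + c * ((L + R) / 2)) / (1 + c)) ^ 2 +
      2 * (3 + c) * ((y - z) / 2 - c * ((L - R) / 2) / (3 + c)) ^ 2 := by
  have : 1 + c ≠ 0 := by positivity
  have : 3 + c ≠ 0 := by positivity
  field_simp
  ring

/-! ### Bottom row -/

lemma xb_zero (m : ℕ) : xb m 0 = q 1 := by simp [xb]

lemma xb_top (m : ℕ) : xb m (2 ^ m) = q 2 := by simp [xb]

lemma xb_left (m j : ℕ) : xb (m + 1) j = Fmap 1 (xb m j) := by
  ext <;> simp [xb, Fmap, q, pow_succ]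
  field_simp

lemma xb_right (m j : ℕ) : xb (m + 1) (j + 2 ^ m) = Fmap 2 (xb m j) := by
  ext <;> simp [xb, Fmap, q, pow_succ]
  field_simp

lemma tri_xb (m j : ℕ) (hj : j ≤ 2 ^ m) : Tri (xb m j) := by
  have h : (j : ℝ) / 2 ^ m ≤ 1 := by
    rw [div_le_one (by positivity)]
    exact_mod_cast hj
  have h0 : 0 ≤ (j : ℝ) / 2 ^ m := by positivity
  intro i
  fin_cases i <;> simp [lam, xb, q] <;> linarith

lemma lower (m : ℕ) (t : ℕ → ℝ) (u : ℝ × ℝ → ℝ) (h : ∀ j ≤ 2 ^ m, u (xb m j) = t j) :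
    S m t + cc m * (u (q 0) - Mean m t) ^ 2 ≤ Energy m u := by
  induction m generalizing t u with
  | zero =>
    have h0 := h 0 (by norm_num)
    have h1 := h (2 ^ 0) (by norm_num)
    rw [xb_zero] at h0
    rw [xb_top, pow_zero] at h1
    rw [Energy_zero, S_zero, Mean_zero, h0, h1]
    simp only [cc]
    apply le_of_eq
    ring
  | succ m ih =>
    have e1 := ih t (u ∘ Fmap 1) (by
      intro j hj
      rw [Function.comp_apply, ← xb_left]
      exact h j (by rw [pow_succ]; omega))
    have e2 := ih (fun j => t (j + 2 ^ m)) (u ∘ Fmap 2) (by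
      intro j hj
      rw [Function.comp_apply, ← xb_right]
      exact h _ (by rw [pow_succ]; omega))
    have e0 := Energy_ge m (u ∘ Fmap 0)
    rw [Energy_succ, S_succ, cc_succ, gd_succ, Mean_succ]
    simp only [Function.comp_apply, Fmap_q_self, Fmap_q_comm 1 0, Fmap_q_comm 2 0] at e0 e1 e2
    have hc := cc_pos m
    have key := min_identity (u (q 0)) (u (Fmap 0 (q 1))) (u (Fmap 0 (q 2)))
      (Mean m t) (Mean m (fun j => t (j + 2 ^ m))) (cc m) hc
    have p1 : 0 ≤ 2 * (1 + cc m) * ((u (Fmap 0 (q 1)) + u (Fmap 0 (q 2))) / 2 -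
      (u (q 0) + cc m * ((Mean m t + Mean m (fun j => t (j + 2 ^ m))) / 2)) / (1 + cc m)) ^ 2 := by
      positivity
    have p2 : 0 ≤ 2 * (3 + cc m) * ((u (Fmap 0 (q 1)) - u (Fmap 0 (q 2))) / 2 -
      cc m * ((Mean m t - Mean m (fun j => t (j + 2 ^ m))) / 2) / (3 + cc m)) ^ 2 := by
      positivity
    linarith

lemma attained (m : ℕ) (t : ℕ → ℝ) (a : ℝ) : ∃ u : ℝ × ℝ → ℝ,
    (∀ j ≤ 2 ^ m, u (xb m j) = t j) ∧ u (q 0) = a ∧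
    Energy m u = S m t + cc m * (a - Mean m t) ^ 2 := by
  induction m generalizing t a with
  | zero =>
    obtain ⟨u, h0, h1, h2, hE⟩ := Energy_harm 0 a (t 0) (t 1)
    refine ⟨u, ?_, h0, ?_⟩
    · intro j hj
      rw [pow_zero] at hj
      interval_cases j
      · rw [xb_zero, h1]
      · rw [← h2, ← xb_top 0, pow_zero]
    · rw [hE, S_zero, Mean_zero]
      simp only [cc]
      ring
  | succ m ih =>
    have hc := cc_pos m
    set L := Mean m t with hL
    set R := Mean m (fun j => t (j + 2 ^ m)) with hR
    set s := (a + cc m * ((L + R) / 2)) / (1 + cc m) with hs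
    set d := cc m * ((L - R) / 2) / (3 + cc m) with hd
    obtain ⟨u0, a0, b0, c0, E0⟩ := Energy_harm m a (s + d) (s - d)
    obtain ⟨u1, B1, a1, E1⟩ := ih t (s + d)
    obtain ⟨u2, B2, a2, E2⟩ := ih (fun j => t (j + 2 ^ m)) (s - d)
    have g1 := B1 _ le_rfl
    have g2 := B2 0 (by positivity)
    rw [xb_top] at g1
    rw [xb_zero, zero_add] at g2
    obtain ⟨U, hU, hE⟩ := glue_energy m ![u0, u1, u2] (by
      intro i j
      fin_cases i <;> fin_cases j <;> simp [a0, b0, c0, a1, a2, g1, g2])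
    refine ⟨U, ?_, ?_, ?_⟩
    · intro j hj
      rcases le_total j (2 ^ m) with hj' | hj'
      · rw [xb_left, hU 1 _ (tri_xb m j hj')]
        exact B1 j hj'
      · obtain ⟨k, rfl⟩ := Nat.exists_eq_add_of_le' hj'
        have hk : k ≤ 2 ^ m := by rw [pow_succ] at hj; omega
        rw [xb_right, hU 2 _ (tri_xb m k hk)]
        exact B2 k hk
    · have := hU 0 (q 0) (tri_q 0)
      rw [Fmap_q_self] at this
      rw [this]
      exact a0
    · rw [hE]
      simp only [Matrix.cons_val]
      rw [E0, E1, E2, S_succ, cc_succ, gd_succ, Mean_succ, ← hL, ← hR]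
      have key := min_identity a (s + d) (s - d) L R (cc m) hc
      rw [← hs, ← hd] at key
      have z1 : (s + d + (s - d)) / 2 - s = 0 := by ring
      have z2 : (s + d - (s - d)) / 2 - d = 0 := by ring
      rw [z1, z2] at key
      linarith

lemma gam_eq (γ : ℕ → ℕ → ℝ)
    (hγ10 : γ 1 0 = 20)
    (hγrec : ∀ m : ℕ, 2 ≤ m → ∀ n < m, γ m n = 10 / 3 * γ (m - 1) n)
    (hγdiag : ∀ m : ℕ, 1 ≤ m → γ m m = 70 * 10 ^ m / (5 * 3 ^ m + 16 * 10 ^ m))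
    (m : ℕ) (hm : 1 ≤ m) (i : ℕ) (hi : i ≤ m) : γ m i = gam m i := by
  induction m, hm using Nat.le_induction with
  | base =>
    interval_cases i
    · rw [hγ10]; norm_num [gam, gd]
    · rw [hγdiag 1 le_rfl]; norm_num [gam, gd]
  | succ m hm ih =>
    rcases Nat.lt_or_ge i (m + 1) with h | h
    · rw [hγrec (m + 1) (by omega) i h, Nat.add_sub_cancel, ih (by omega)]
      unfold gam
      rw [Nat.succ_sub (by omega), pow_succ]
      ring
    · obtain rfl : i = m + 1 := by omega
      rw [hγdiag _ (by omega)]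
      simp [gam, gd]

/-- Haar decomposition of the minimal energy over the bottom row:
for `m ≥ 1` and any prescribed values `t₀, …, t_{2^m}`,
`Q_{Ẽ_m}(t) = Σ_{i=0}^m γ^m_i Σ_{j=0}^{2^{m−i}−1} (D^m_{m−i,j})²`, where
`γ¹₀ = 20`, `γ^m_n = (10/3)γ^{m−1}_n` for `m ≥ 2`, `0 ≤ n < m`, and
`γ^m_m = 70·10^m/(5·3^m + 16·10^m)` for `m ≥ 1`. -/
theorem stmt17 (γ : ℕ → ℕ → ℝ)
    (hγ10 : γ 1 0 = 20)
    (hγrec : ∀ m : ℕ, 2 ≤ m → ∀ n < m, γ m n = 10 / 3 * γ (m - 1) n)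
    (hγdiag : ∀ m : ℕ, 1 ≤ m → γ m m = 70 * 10 ^ m / (5 * 3 ^ m + 16 * 10 ^ m))
    (m : ℕ) (hm : 1 ≤ m) (t : ℕ → ℝ) :
    sInf {r : ℝ | ∃ u : ℝ × ℝ → ℝ, (∀ j ≤ 2 ^ m, u (xb m j) = t j) ∧ r = Energy m u} =
      ∑ i ∈ Finset.range (m + 1), γ m i *
        ∑ j ∈ Finset.range (2 ^ (m - i)), (Dcoef m t (m - i) j) ^ 2 := by
  have hS : S m t = ∑ i ∈ Finset.range (m + 1), γ m i *
        ∑ j ∈ Finset.range (2 ^ (m - i)), (Dcoef m t (m - i) j) ^ 2 := by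
    unfold S
    apply Finset.sum_congr rfl
    intro i hi
    rw [gam_eq γ hγ10 hγrec hγdiag m hm i (Nat.lt_succ_iff.1 (Finset.mem_range.1 hi))]
  rw [← hS]
  apply IsLeast.csInf_eq
  constructor
  · obtain ⟨u, h1, _, h3⟩ := attained m t (Mean m t)
    exact ⟨u, h1, by rw [h3]; simp⟩
  · rintro r ⟨u, hu, rfl⟩
    have := lower m t u hu
    have h2 : 0 ≤ cc m * (u (q 0) - Mean m t) ^ 2 := mul_nonneg (cc_pos m).le (sq_nonneg _)
    linarith

end SGPaper
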